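/- arXiv:1912.00551 — 4 statements merged into one kernel-verified Lean document; each statement's English description precedes it below -/
import Mathlib

section
/- (Theorem 2, hybrid beamformer with 1-bit phase shifters and two Tx/Rx front ends.) Let N_t, N_r ≥ 1 and W ∈ ℂ^{N_r×N_t} be arbitrary. For each q = 1,…,N_r·N_t set n_r = 1 + (q−1) mod N_r and n_t = ⌈q/N_r⌉, and for x ∈ {t, r} define F_{x,q} = [𝟙_{N_x}, 2e_{n_x} − 𝟙_{N_x}] ∈ {−1, +1}^{N_x×2} and c_{x,q} = (s_q/2)·(1,1)ᵀ ∈ ℂ², where s_q ∈ ℂ is any complex number with s_q² = W_{n_r, n_t}. Then W = Σ_{q=1}^{N_r N_t} F_{r,q} c_{r,q} c_{t,q}ᵀ F_{t,q}ᵀ. In particular, every entry of every F_{x,q} lies in {−1, +1} = {exp(i·0), exp(i·π)}, i.e., has a phase from the 1-bit quantized set Φ(1) = {0, π}. -/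
/-- Feeding both columns of `[𝟙, 2e_m - 𝟙]` with weight `z / 2` gives `z e_m`. -/
theorem mulVec_oneBit_half {N : ℕ} (F : Matrix (Fin N) (Fin 2) ℂ) (m : Fin N) (z : ℂ)
    (hF : ∀ n, F n 0 = 1 ∧ F n 1 = 2 * (if n = m then 1 else 0) - 1) (n : Fin N) :
    F.mulVec (fun _ => z / 2) n = if n = m then z else 0 := by
  rw [Matrix.mulVec, dotProduct, Fin.sum_univ_two, (hF n).1, (hF n).2]
  split_ifs <;> ring

/-- The entries of `[𝟙, 2e_m - 𝟙]` are `±1`. -/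
theorem oneBit_entry {N : ℕ} (F : Matrix (Fin N) (Fin 2) ℂ) (m : Fin N)
    (hF : ∀ n, F n 0 = 1 ∧ F n 1 = 2 * (if n = m then 1 else 0) - 1) (n : Fin N) (j : Fin 2) :
    F n j = 1 ∨ F n j = -1 := by
  fin_cases j
  · exact Or.inl (hF n).1
  · by_cases h : n = m
    · left
      simpa [h, show (2 : ℂ) - 1 = 1 by norm_num] using (hF n).2
    · right
      simpa [h] using (hF n).2


/-- Theorem 2: hybrid beamformer with 1-bit phase shifters and two Tx/Rx front
ends: with `F_{x,q} = [𝟙, 2e_{n_x} - 𝟙]` and `c_{x,q} = (s_q/2)(1,1)ᵀ`, `s_q² = W_{n_r,n_t}`,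
any `W` factorizes using `Q = N_r N_t` component images, and all analog entries lie in
`{-1, +1}`. -/
theorem hybrid_one_bit_two_front_ends (Nt Nr : ℕ) (hNt : 1 ≤ Nt) (hNr : 1 ≤ Nr)
    (W : Matrix (Fin Nr) (Fin Nt) ℂ)
    (nr : Fin (Nr * Nt) → Fin Nr) (nt : Fin (Nr * Nt) → Fin Nt)
    (hnr : ∀ q, (nr q : ℕ) = (q : ℕ) % Nr)
    (hnt : ∀ q, (nt q : ℕ) = (q : ℕ) / Nr)
    (s : Fin (Nr * Nt) → ℂ) (hs : ∀ q, s q ^ 2 = W (nr q) (nt q))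
    (Fr : Fin (Nr * Nt) → Matrix (Fin Nr) (Fin 2) ℂ)
    (Ft : Fin (Nr * Nt) → Matrix (Fin Nt) (Fin 2) ℂ)
    (cr ct : Fin (Nr * Nt) → Fin 2 → ℂ)
    (hFr : ∀ q n, Fr q n 0 = 1 ∧ Fr q n 1 = 2 * (if n = nr q then 1 else 0) - 1)
    (hFt : ∀ q n, Ft q n 0 = 1 ∧ Ft q n 1 = 2 * (if n = nt q then 1 else 0) - 1)
    (hcr : ∀ q, cr q = fun _ => s q / 2) (hct : ∀ q, ct q = fun _ => s q / 2) :
    W = ∑ q, Matrix.vecMulVec ((Fr q).mulVec (cr q)) ((Ft q).mulVec (ct q)) ∧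
    (∀ q n j, Fr q n j = 1 ∨ Fr q n j = -1) ∧
    (∀ q n j, Ft q n j = 1 ∨ Ft q n j = -1) := by
  have bij : Function.Bijective fun q => (nr q, nt q) := by
    rw [Fintype.bijective_iff_injective_and_card]
    refine ⟨fun p q hpq => ?_, by simp⟩
    obtain ⟨h1, h2⟩ := Prod.ext_iff.mp hpq
    have h1' : (p : ℕ) % Nr = (q : ℕ) % Nr := by
      rw [← hnr, ← hnr]
      exact congrArg Fin.val h1
    have h2' : (p : ℕ) / Nr = (q : ℕ) / Nr := by
      rw [← hnt, ← hnt]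
      exact congrArg Fin.val h2
    ext
    rw [← Nat.mod_add_div (p : ℕ) Nr, ← Nat.mod_add_div (q : ℕ) Nr, h1', h2']
  have hr : ∀ q n, (Fr q).mulVec (cr q) n = if n = nr q then s q else 0 := fun q n => by
    rw [hcr, mulVec_oneBit_half (Fr q) (nr q) (s q) (hFr q) n]
  have ht : ∀ q n, (Ft q).mulVec (ct q) n = if n = nt q then s q else 0 := fun q n => by
    rw [hct, mulVec_oneBit_half (Ft q) (nt q) (s q) (hFt q) n]
  refine ⟨?_, fun q => oneBit_entry (Fr q) (nr q) (hFr q),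
    fun q => oneBit_entry (Ft q) (nt q) (hFt q)⟩
  ext i j
  obtain ⟨q, hq⟩ := bij.2 (i, j)
  obtain ⟨rfl, rfl⟩ := Prod.ext_iff.mp hq
  rw [Matrix.sum_apply, Finset.sum_eq_single q]
  · simp [Matrix.vecMulVec_apply, hr, ht, ← hs, sq]
  · intro p _ hp
    have hne : ¬ (nr q = nr p ∧ nt q = nt p) := fun h =>
      hp (bij.1 (Prod.ext h.1.symm h.2.symm))
    rw [Matrix.vecMulVec_apply, hr, ht]
    split_ifs with h1 h2
    · exact absurd ⟨h1, h2⟩ hne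
    all_goals simp
  · simp
end

section
/- (Theorem 4, fully analog beamformer with 1-bit phase shifters.) Let N_t, N_r ≥ 1 and W ∈ ℂ^{N_r×N_t} be arbitrary. For q = 1,…,4·N_r·N_t define i_r = ⌈(1 + (q−1) mod 4)/2⌉, i_t = 1 + (q−1) mod 2, n_r = 1 + (⌈q/4⌉ − 1) mod N_r, n_t = ⌈q/(4N_r)⌉, and for x ∈ {t, r} set f_{x,q} = (e_{n_x} − 𝟙_{N_x})·(−1)^{i_x} + e_{n_x} ∈ {−1, +1}^{N_x} and c_{x,q} = s_q/2, where s_q ∈ ℂ is any complex number with s_q² = W_{n_r, n_t}. Then W = Σ_{q=1}^{4 N_r N_t} c_{r,q}·c_{t,q}·f_{r,q} f_{t,q}ᵀ, and every entry of every f_{x,q} lies in {−1, +1} = {exp(i·0), exp(i·π)}. -/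
/-- Indices `q < 4 * m * n` enumerate triples `(t, r, k)` through `q = 4 * m * t + 4 * r + k`. -/
def tripleEquiv (m n : ℕ) : Fin n × Fin m × Fin 4 ≃ Fin (4 * m * n) :=
  ((Equiv.refl _).prodCongr finProdFinEquiv).trans
    (finProdFinEquiv.trans (finCongr (by ring)))

theorem tripleEquiv_val {m n : ℕ} (t : Fin n) (r : Fin m) (k : Fin 4) :
    (tripleEquiv m n (t, r, k) : ℕ) = k + 4 * (r + m * t) := by
  simp only [tripleEquiv, Equiv.trans_apply, Equiv.prodCongr_apply, Prod.map_apply,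
    Equiv.refl_apply, finProdFinEquiv_apply_val, finCongr_apply, Fin.val_cast]
  ring

theorem tripleEquiv_div_four {m n : ℕ} (t : Fin n) (r : Fin m) (k : Fin 4) :
    (tripleEquiv m n (t, r, k) : ℕ) / 4 = r + m * t := by
  rw [tripleEquiv_val]
  omega

/-- The vector `(e - 𝟙) σ + e` with `σ = (-1) ^ j` has entries in `{1, -1}`. -/
theorem oneBit_entry_s11 (p : Prop) [Decidable p] (j : ℕ) :
    ((if p then 1 else 0) - 1) * (-1 : ℂ) ^ j + (if p then 1 else 0) = 1 ∨
      ((if p then 1 else 0) - 1) * (-1 : ℂ) ^ j + (if p then 1 else 0) = -1 := by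
  rcases neg_one_pow_eq_or ℂ j with h | h <;> by_cases hp : p <;> simp [h, hp]


/-- Theorem 4: fully analog beamformer with 1-bit phase shifters: any `W`
factorizes using `4 N_r N_t` component images with analog weights
`f_{x,q} = (e_{n_x} - 𝟙)(-1)^{i_x} + e_{n_x}` whose entries lie in `{-1, +1}`. -/
theorem analog_one_bit (Nt Nr : ℕ) (hNt : 1 ≤ Nt) (hNr : 1 ≤ Nr)
    (W : Matrix (Fin Nr) (Fin Nt) ℂ)
    (nr : Fin (4 * Nr * Nt) → Fin Nr) (nt : Fin (4 * Nr * Nt) → Fin Nt)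
    (hnr : ∀ q, (nr q : ℕ) = (q : ℕ) / 4 % Nr)
    (hnt : ∀ q, (nt q : ℕ) = (q : ℕ) / (4 * Nr))
    (s : Fin (4 * Nr * Nt) → ℂ) (hs : ∀ q, s q ^ 2 = W (nr q) (nt q))
    (fr : Fin (4 * Nr * Nt) → Fin Nr → ℂ) (ft : Fin (4 * Nr * Nt) → Fin Nt → ℂ)
    (cr ct : Fin (4 * Nr * Nt) → ℂ)
    (hfr : ∀ q n, fr q n =
      ((if n = nr q then 1 else 0) - 1) * (-1 : ℂ) ^ ((q : ℕ) % 4 / 2 + 1)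
        + (if n = nr q then 1 else 0))
    (hft : ∀ q n, ft q n =
      ((if n = nt q then 1 else 0) - 1) * (-1 : ℂ) ^ ((q : ℕ) % 2 + 1)
        + (if n = nt q then 1 else 0))
    (hcr : ∀ q, cr q = s q / 2) (hct : ∀ q, ct q = s q / 2) :
    W = ∑ q, (cr q * ct q) • Matrix.vecMulVec (fr q) (ft q) ∧
    (∀ q n, fr q n = 1 ∨ fr q n = -1) ∧
    (∀ q n, ft q n = 1 ∨ ft q n = -1) := by
  refine ⟨?_, fun q n => ?_, fun q n => ?_⟩
  · ext a b
    rw [← (tripleEquiv Nr Nt).sum_comp, Matrix.sum_apply, Fintype.sum_prod_type]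
    have hr : ∀ t r k, nr (tripleEquiv Nr Nt (t, r, k)) = r := fun t r k => by
      ext
      rw [hnr, tripleEquiv_div_four, Nat.add_mul_mod_self_left, Nat.mod_eq_of_lt r.isLt]
    have ht : ∀ t r k, nt (tripleEquiv Nr Nt (t, r, k)) = t := fun t r k => by
      ext
      rw [hnt, ← Nat.div_div_eq_div_mul, tripleEquiv_div_four,
        Nat.add_mul_div_left _ _ (by omega), Nat.div_eq_of_lt r.isLt, zero_add]
    have hc : ∀ t r k, cr (tripleEquiv Nr Nt (t, r, k)) * ct (tripleEquiv Nr Nt (t, r, k)) =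
        W r t / 4 := fun t r k => by
      have h := hs (tripleEquiv Nr Nt (t, r, k))
      rw [hr, ht] at h
      rw [hcr, hct, ← h]
      ring
    have hmod : ∀ t r k, (tripleEquiv Nr Nt (t, r, k) : ℕ) % 4 = k := fun t r k => by
      rw [tripleEquiv_val]
      omega
    have hpar : ∀ t r k, (tripleEquiv Nr Nt (t, r, k) : ℕ) % 2 = (k : ℕ) % 2 := fun t r k => by
      rw [tripleEquiv_val]
      omega
    have hsum : ∀ t r, ∑ k, ((cr (tripleEquiv Nr Nt (t, r, k)) *
        ct (tripleEquiv Nr Nt (t, r, k))) • Matrix.vecMulVec (fr (tripleEquiv Nr Nt (t, r, k)))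
          (ft (tripleEquiv Nr Nt (t, r, k)))) a b =
        if b = t then (if a = r then W r t else 0) else 0 := fun t r => by
      simp only [Matrix.smul_apply, Matrix.vecMulVec_apply, hc, hfr, hft, hr, ht, hmod, hpar,
        Fin.sum_univ_four, smul_eq_mul]
      by_cases hb : b = t <;> by_cases ha : a = r <;> simp [ha, hb] <;> ring
    simp only [Fintype.sum_prod_type, hsum]
    simp
  · rw [hfr]
    exact oneBit_entry_s11 _ _
  · rw [hft]
    exact oneBit_entry_s11 _ _
end

section
/- (Corollary of Theorem 2.) Let N_t, N_r ≥ 1, let M ≥ 2, and let B ≥ 1 be an integer. Then for every W ∈ ℂ^{N_r×N_t} there exist, for q = 1,…,N_r·N_t and x ∈ {t, r}, matrices F_{x,q} ∈ ℂ^{N_x×M} all of whose entries lie in the quantized-phase set {exp(i·2πk/2^B) : k = 0, 1, …, 2^B − 1}, and vectors c_{x,q} ∈ ℂ^M, such that W = Σ_{q=1}^{N_r N_t} F_{r,q} c_{r,q} c_{t,q}ᵀ F_{t,q}ᵀ. Hence the number of component images of a hybrid beamformer with M ≥ 2 front ends is at most N_r·N_t for every number B ≥ 1 of phase-shift bits.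 -/
/-- Both signs lie in the `B`-bit quantized phase set. -/
theorem exists_quantizedPhase_eq_ite {B : ℕ} (hB : 1 ≤ B) (p : Prop) [Decidable p] :
    ∃ k : ℕ, k < 2 ^ B ∧ (if p then -1 else 1 : ℂ) =
      Complex.exp (Complex.I * ((2 * Real.pi * k / 2 ^ B : ℝ) : ℂ)) := by
  split_ifs
  · refine ⟨2 ^ (B - 1), Nat.pow_lt_pow_right one_lt_two (by omega), ?_⟩
    have h : (2 * Real.pi * ((2 ^ (B - 1) : ℕ) : ℝ) / 2 ^ B : ℝ) = Real.pi := by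
      obtain ⟨b, rfl⟩ := Nat.exists_eq_add_of_le' hB
      push_cast
      rw [pow_succ]
      field_simp
    rw [h, mul_comm, Complex.exp_pi_mul_I]
  · exact ⟨0, by positivity, by simp⟩

/-- Every scaled standard basis vector is a combination of the columns of a matrix with entries
in the `B`-bit quantized phase set, as soon as there are two columns. -/
theorem exists_quantizedPhase_mulVec_eq_single {N M B : ℕ} (hM : 2 ≤ M) (hB : 1 ≤ B)
    (a : Fin N) (w : ℂ) :
    ∃ (F : Matrix (Fin N) (Fin M) ℂ) (c : Fin M → ℂ),
      (∀ n j, ∃ k : ℕ, k < 2 ^ B ∧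
        F n j = Complex.exp (Complex.I * ((2 * Real.pi * k / 2 ^ B : ℝ) : ℂ))) ∧
      F.mulVec c = Pi.single a w := by
  let i₀ : Fin M := ⟨0, by omega⟩
  let i₁ : Fin M := ⟨1, by omega⟩
  have hne : i₀ ≠ i₁ := by simp [i₀, i₁]
  refine ⟨Matrix.of fun n j => if j = i₁ ∧ n ≠ a then -1 else 1,
    Pi.single i₀ (w / 2) + Pi.single i₁ (w / 2),
    fun n j => exists_quantizedPhase_eq_ite hB _, ?_⟩
  ext n
  rw [Matrix.mulVec_add, Matrix.mulVec_single, Matrix.mulVec_single]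
  by_cases hn : n = a
  · subst hn
    simpa [div_eq_mul_inv] using add_halves w
  · simp [hn, hne]

/-- corollary of Theorem 2: for any `W`, any `M ≥ 2` front ends and any
`B ≥ 1` phase-shift bits, there is a hybrid factorization of `W` with `N_r N_t` component
images whose analog entries all lie in the `B`-bit quantized phase set. -/
theorem hybrid_quantized_component_image_bound (Nt Nr M B : ℕ)
    (hNt : 1 ≤ Nt) (hNr : 1 ≤ Nr) (hM : 2 ≤ M) (hB : 1 ≤ B)
    (W : Matrix (Fin Nr) (Fin Nt) ℂ) :
    ∃ (Fr : Fin (Nr * Nt) → Matrix (Fin Nr) (Fin M) ℂ)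
      (Ft : Fin (Nr * Nt) → Matrix (Fin Nt) (Fin M) ℂ)
      (cr ct : Fin (Nr * Nt) → Fin M → ℂ),
      (∀ q n j, ∃ k : ℕ, k < 2 ^ B ∧
        Fr q n j = Complex.exp (Complex.I * ((2 * Real.pi * k / 2 ^ B : ℝ) : ℂ))) ∧
      (∀ q n j, ∃ k : ℕ, k < 2 ^ B ∧
        Ft q n j = Complex.exp (Complex.I * ((2 * Real.pi * k / 2 ^ B : ℝ) : ℂ))) ∧
      W = ∑ q, Matrix.vecMulVec ((Fr q).mulVec (cr q)) ((Ft q).mulVec (ct q)) := by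
  let e : Fin (Nr * Nt) ≃ Fin Nr × Fin Nt := finProdFinEquiv.symm
  choose Fr cr hFr hcr using fun q =>
    exists_quantizedPhase_mulVec_eq_single hM hB (e q).1 (W (e q).1 (e q).2)
  choose Ft ct hFt hct using fun q =>
    exists_quantizedPhase_mulVec_eq_single hM hB (e q).2 1
  refine ⟨Fr, Ft, cr, ct, hFr, hFt, ?_⟩
  simp_rw [hcr, hct]
  rw [e.sum_comp fun p => Matrix.vecMulVec (Pi.single p.1 (W p.1 p.2)) (Pi.single p.2 1),
    Fintype.sum_prod_type]
  ext i j
  simp [Matrix.sum_apply, Matrix.vecMulVec_apply, Pi.single_apply]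
end

section
/- (Corollary of Theorem 4.) Let N_t, N_r ≥ 1 and let B ≥ 1 be an integer. Then for every W ∈ ℂ^{N_r×N_t} there exist, for q = 1,…,4·N_r·N_t and x ∈ {t, r}, vectors f_{x,q} ∈ ℂ^{N_x} all of whose entries lie in the quantized-phase set {exp(i·2πk/2^B) : k = 0, 1, …, 2^B − 1}, and scalars c_{x,q} ∈ ℂ, such that W = Σ_{q=1}^{4 N_r N_t} c_{r,q}·c_{t,q}·f_{r,q} f_{t,q}ᵀ. Hence the number of component images of a fully analog beamformer is at most 4·N_r·N_t for every number B ≥ 1 of phase-shift bits. -/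
/-- The all-ones vector (`b = false`), or the all-ones vector with the sign of entry `m` flipped
(`b = true`). -/
def signFlip {ι : Type*} [DecidableEq ι] (b : Bool) (m n : ι) : ℂ :=
  if b = true ∧ n = m then -1 else 1

/-- The weight of `signFlip b m` in the standard basis vector at `m`. -/
noncomputable def signFlipWeight (b : Bool) : ℂ := if b = true then -(1 / 2) else 1 / 2

lemma signFlip_eq_one_or_neg_one {ι : Type*} [DecidableEq ι] (b : Bool) (m n : ι) :
    signFlip b m n = 1 ∨ signFlip b m n = -1 := by
  unfold signFlip
  split_ifs <;> simp

lemma sum_signFlipWeight_mul_signFlip {ι : Type*} [DecidableEq ι] (m n : ι) :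
    ∑ b, signFlipWeight b * signFlip b m n = if n = m then 1 else 0 := by
  by_cases h : n = m <;> simp [signFlipWeight, signFlip, h] <;> norm_num

lemma exists_quantized_phase_of_sign {B : ℕ} (hB : 1 ≤ B) {z : ℂ} (hz : z = 1 ∨ z = -1) :
    ∃ k : ℕ, k < 2 ^ B ∧
      z = Complex.exp (Complex.I * ((2 * Real.pi * k / 2 ^ B : ℝ) : ℂ)) := by
  rcases hz with rfl | rfl
  · exact ⟨0, by positivity, by simp⟩
  · obtain ⟨b, rfl⟩ := Nat.exists_eq_add_of_le' hB
    refine ⟨2 ^ b, Nat.pow_lt_pow_right one_lt_two b.lt_succ_self, ?_⟩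
    have h : (2 * Real.pi * (2 ^ b : ℕ) / 2 ^ (b + 1) : ℝ) = Real.pi := by
      push_cast
      field_simp
      ring
    rw [h, mul_comm, Complex.exp_pi_mul_I]

lemma matrix_eq_sum_smul_vecMulVec_signFlip {m n : Type*} [Fintype m] [Fintype n]
    [DecidableEq m] [DecidableEq n] (W : Matrix m n ℂ) :
    W = ∑ p : (m × n) × Bool × Bool,
      (W p.1.1 p.1.2 * signFlipWeight p.2.1 * signFlipWeight p.2.2) •
        Matrix.vecMulVec (signFlip p.2.1 p.1.1) (signFlip p.2.2 p.1.2) := by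
  ext i j
  simp only [Matrix.sum_apply, Matrix.smul_apply, Matrix.vecMulVec_apply, smul_eq_mul]
  rw [Fintype.sum_prod_type]
  have key : ∀ q : m × n,
      ∑ c : Bool × Bool, W q.1 q.2 * signFlipWeight c.1 * signFlipWeight c.2 *
        (signFlip c.1 q.1 i * signFlip c.2 q.2 j) =
      W q.1 q.2 * ((if i = q.1 then 1 else 0) * (if j = q.2 then 1 else 0)) := by
    intro q
    rw [← sum_signFlipWeight_mul_signFlip, ← sum_signFlipWeight_mul_signFlip,
      Finset.sum_mul_sum, Fintype.sum_prod_type, Finset.mul_sum]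
    refine Finset.sum_congr rfl fun a _ => ?_
    rw [Finset.mul_sum]
    exact Finset.sum_congr rfl fun b _ => by ring
  simp only [key, Fintype.sum_prod_type]
  simp

/-- corollary of Theorem 4: for any `W` and any `B ≥ 1` phase-shift bits,
there is a fully analog factorization of `W` with `4 N_r N_t` component images whose analog
entries all lie in the `B`-bit quantized phase set. -/
theorem analog_quantized_component_image_bound (Nt Nr B : ℕ)
    (hNt : 1 ≤ Nt) (hNr : 1 ≤ Nr) (hB : 1 ≤ B)
    (W : Matrix (Fin Nr) (Fin Nt) ℂ) :
    ∃ (fr : Fin (4 * Nr * Nt) → Fin Nr → ℂ) (ft : Fin (4 * Nr * Nt) → Fin Nt → ℂ)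
      (cr ct : Fin (4 * Nr * Nt) → ℂ),
      (∀ q n, ∃ k : ℕ, k < 2 ^ B ∧
        fr q n = Complex.exp (Complex.I * ((2 * Real.pi * k / 2 ^ B : ℝ) : ℂ))) ∧
      (∀ q n, ∃ k : ℕ, k < 2 ^ B ∧
        ft q n = Complex.exp (Complex.I * ((2 * Real.pi * k / 2 ^ B : ℝ) : ℂ))) ∧
      W = ∑ q, (cr q * ct q) • Matrix.vecMulVec (fr q) (ft q) := by
  have hcard : Fintype.card (Fin (4 * Nr * Nt)) =
      Fintype.card ((Fin Nr × Fin Nt) × Bool × Bool) := by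
    simp only [Fintype.card_prod, Fintype.card_fin, Fintype.card_bool]
    ring
  let e := Fintype.equivOfCardEq hcard
  refine ⟨fun q => signFlip (e q).2.1 (e q).1.1, fun q => signFlip (e q).2.2 (e q).1.2,
    fun q => W (e q).1.1 (e q).1.2 * signFlipWeight (e q).2.1,
    fun q => signFlipWeight (e q).2.2,
    fun q n => exists_quantized_phase_of_sign hB (signFlip_eq_one_or_neg_one _ _ _),
    fun q n => exists_quantized_phase_of_sign hB (signFlip_eq_one_or_neg_one _ _ _), ?_⟩
  exact (matrix_eq_sum_smul_vecMulVec_signFlip W).trans (Equiv.sum_comp e _).symm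
end
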